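/- Under the stated assumptions, for every m ≥ 0 with r_G ≥ 2√(p_G) + √(2x) + m: ∫_{Uᶜ} ‖D_V u‖^m e^{F(u)} du ≤ 4·e^{−x − p_G/2} · Z, and ∫_{Uᶜ} ‖D_V u‖^m e^{−‖D_G u‖²/2} du ≤ e^{−x − p_G/2} · Z. -/

import Mathlib

open MeasureTheory Real Matrix

/-- `gaussNorm D u = ‖D u‖`, the Euclidean norm of the matrix `D` applied to `u`. -/
noncomputable def gaussNorm {p : ℕ} (D : Matrix (Fin p) (Fin p) ℝ)
    (u : EuclideanSpace ℝ (Fin p)) : ℝ :=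
  ‖(Matrix.toEuclideanLin D) u‖

lemma gaussNorm_sq {p : ℕ} (D : Matrix (Fin p) (Fin p) ℝ) (u : EuclideanSpace ℝ (Fin p)) :
    gaussNorm D u ^ 2 = u.ofLp ⬝ᵥ ((Dᵀ * D) *ᵥ u.ofLp) := by
  rw [gaussNorm, EuclideanSpace.real_norm_sq_eq, ← Matrix.mulVec_mulVec, Matrix.dotProduct_mulVec,
    Matrix.vecMul_transpose]
  simp [Matrix.toLpLin_apply, dotProduct, sq]

lemma diag_lemma {p : ℕ} (DG DV : Matrix (Fin p) (Fin p) ℝ) (hDG : DG.PosDef) (hDV : DV.PosDef)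
    (hLoewner : (DG * DG - DV * DV).PosSemidef) :
    ∃ (L : EuclideanSpace ℝ (Fin p) →ₗ[ℝ] EuclideanSpace ℝ (Fin p)) (b : Fin p → ℝ),
      LinearMap.det L ≠ 0 ∧ (∀ i, 0 < b i) ∧ (∀ i, b i ≤ 1) ∧
      ∑ i, b i = ((DV * DV) * (DG * DG)⁻¹).trace ∧
      (∀ w, gaussNorm DG (L w) ^ 2 = ∑ i, w i ^ 2) ∧
      (∀ w, gaussNorm DV (L w) ^ 2 = ∑ i, b i * w i ^ 2) := by
  have hGT : DGᵀ = DG := by simpa [Matrix.conjTranspose_eq_transpose_of_trivial] using hDG.isHermitian.eq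
  have hVT : DVᵀ = DV := by simpa [Matrix.conjTranspose_eq_transpose_of_trivial] using hDV.isHermitian.eq
  have hGdet : IsUnit DG.det := hDG.det_pos.ne'.isUnit
  have hVdet : IsUnit DV.det := hDV.det_pos.ne'.isUnit
  set N := DG⁻¹ * (DV * DV) * DG⁻¹ with hN
  have hNh : N.IsHermitian := by
    rw [Matrix.IsHermitian, Matrix.conjTranspose_eq_transpose_of_trivial, hN]
    simp only [Matrix.transpose_mul, Matrix.transpose_nonsing_inv, hGT, hVT, Matrix.mul_assoc]
  set O : Matrix (Fin p) (Fin p) ℝ := (hNh.eigenvectorUnitary : Matrix (Fin p) (Fin p) ℝ) with hO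
  have hOO : Oᵀ * O = 1 := by
    have := Unitary.coe_star_mul_self hNh.eigenvectorUnitary
    simpa [Matrix.star_eq_conjTranspose, Matrix.conjTranspose_eq_transpose_of_trivial] using this
  have hsp : Oᵀ * N * O = Matrix.diagonal hNh.eigenvalues := by
    have := hNh.conjStarAlgAut_star_eigenvectorUnitary
    rw [Unitary.conjStarAlgAut_apply] at this
    simpa [Matrix.star_eq_conjTranspose, Matrix.conjTranspose_eq_transpose_of_trivial, Function.comp_def] using this
  set M := DG⁻¹ * O with hM
  have hMG : (DG * M)ᵀ * (DG * M) = 1 := by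
    have : DG * M = O := by
      rw [hM, ← Matrix.mul_assoc, Matrix.mul_nonsing_inv _ hGdet, Matrix.one_mul]
    rw [this, hOO]
  have hMV : (DV * M)ᵀ * (DV * M) = Matrix.diagonal hNh.eigenvalues := by
    rw [← hsp, hM, hN]
    simp only [Matrix.transpose_mul, Matrix.transpose_nonsing_inv, hGT, hVT, Matrix.mul_assoc]
  have hcomp : ∀ (D : Matrix (Fin p) (Fin p) ℝ) w,
      gaussNorm D (Matrix.toEuclideanLin M w) = gaussNorm (D * M) w := by
    intro D w
    simp [gaussNorm]
  have hG : ∀ w, gaussNorm DG (Matrix.toEuclideanLin M w) ^ 2 = ∑ i, w i ^ 2 := by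
    intro w
    rw [hcomp, gaussNorm_sq, hMG]
    simp [dotProduct, sq]
  have hV : ∀ w, gaussNorm DV (Matrix.toEuclideanLin M w) ^ 2 =
      ∑ i, hNh.eigenvalues i * w i ^ 2 := by
    intro w
    rw [hcomp, gaussNorm_sq, hMV]
    simp only [dotProduct, Matrix.mulVec_diagonal]
    exact Finset.sum_congr rfl fun i _ => by ring
  have hMdet : M.det ≠ 0 := by
    intro h
    have := congrArg Matrix.det hMG
    simp [Matrix.det_mul, h] at this
  have hle : ∀ u, gaussNorm DV u ^ 2 ≤ gaussNorm DG u ^ 2 := by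
    intro u
    have := hLoewner.dotProduct_mulVec_nonneg u.ofLp
    rw [Matrix.sub_mulVec, dotProduct_sub] at this
    rw [gaussNorm_sq, gaussNorm_sq, hGT, hVT]
    simpa using this
  have hGe := fun i => hG (EuclideanSpace.single i 1)
  have hVe := fun i => hV (EuclideanSpace.single i 1)
  simp at hVe
  refine ⟨Matrix.toEuclideanLin M, hNh.eigenvalues, ?_, ?_, ?_, ?_, hG, hV⟩
  · rw [Matrix.toEuclideanLin_eq_toLin_orthonormal, LinearMap.det_toLin]; exact hMdet
  · intro i
    rw [← hVe i]
    have : gaussNorm DV (Matrix.toEuclideanLin M (EuclideanSpace.single i 1)) ≠ 0 := by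
      rw [hcomp, gaussNorm, norm_ne_zero_iff]
      intro h
      have h2 : (DV * M) *ᵥ (Pi.single i 1) = 0 := congrArg WithLp.ofLp h
      have h3 := Matrix.eq_zero_of_mulVec_eq_zero (by
        rw [Matrix.det_mul]; exact mul_ne_zero hVdet.ne_zero hMdet) h2
      have := congrFun h3 i
      simp at this
    positivity
  · intro i
    rw [← hVe i]
    refine (hle _).trans ?_
    rw [hGe]
    simp
  · have := hNh.trace_eq_sum_eigenvalues
    simp at this
    rw [← this, hN, Matrix.mul_assoc, Matrix.trace_mul_comm, Matrix.mul_inv_rev, Matrix.mul_assoc]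

lemma one_dim_bound {b s : ℝ} (hb0 : 0 ≤ b) (hb1 : b ≤ 1) (hs : 0 < s) :
    0 < 1 - (1 - s) * b ∧
    √(π / ((1 - (1 - s) * b) / 2)) ≤ s ^ (-b / 2) * √(π / (1 / 2)) := by
  have h := Real.geom_mean_le_arith_mean2_weighted (sub_nonneg.2 hb1) hb0 zero_le_one hs.le (by ring)
  rw [Real.one_rpow, one_mul] at h
  have hsb : 0 < s ^ b := Real.rpow_pos_of_pos hs b
  have hle : s ^ b ≤ 1 - (1 - s) * b := by linarith
  refine ⟨by linarith, ?_⟩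
  have e : s ^ (-b / 2) = √((s ^ b)⁻¹) := by
    rw [Real.sqrt_eq_rpow, ← Real.rpow_neg hs.le, ← Real.rpow_mul hs.le]
    ring_nf
  rw [e, ← Real.sqrt_mul (by positivity)]
  apply Real.sqrt_le_sqrt
  rw [div_div_eq_mul_div, div_div_eq_mul_div, div_one, div_eq_inv_mul]
  gcongr

lemma gauss_pi {p : ℕ} (c : Fin p → ℝ) (hc : ∀ i, 0 < c i) :
    Integrable (fun w : EuclideanSpace ℝ (Fin p) => exp (-(∑ i, c i * w i ^ 2) / 2)) ∧
    ∫ w : EuclideanSpace ℝ (Fin p), exp (-(∑ i, c i * w i ^ 2) / 2) = ∏ i, √(π / (c i / 2)) := by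
  have e : ∀ v : Fin p → ℝ, exp (-(∑ i, c i * v i ^ 2) / 2) = ∏ i, exp (-(c i / 2) * v i ^ 2) := by
    intro v
    rw [← Real.exp_sum, neg_div, Finset.sum_div, ← Finset.sum_neg_distrib]
    congr 1
    exact Finset.sum_congr rfl fun i _ => by ring
  constructor
  · rw [← (PiLp.volume_preserving_toLp (Fin p)).integrable_comp_emb
      (MeasurableEquiv.toLp 2 _).measurableEmbedding]
    simp only [Function.comp_def, e]
    exact Integrable.fintype_prod (f := fun i (v : ℝ) => exp (-(c i / 2) * v ^ 2))
      (fun i => integrable_exp_neg_mul_sq (half_pos (hc i)))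
  · rw [← (PiLp.volume_preserving_toLp (Fin p)).integral_comp
      (MeasurableEquiv.toLp 2 _).measurableEmbedding]
    simp only [e]
    rw [integral_fintype_prod_volume_eq_prod (fun i (v : ℝ) => exp (-(c i / 2) * v ^ 2))]
    simp only [integral_gaussian]

lemma change_var {p : ℕ} (L : EuclideanSpace ℝ (Fin p) →ₗ[ℝ] EuclideanSpace ℝ (Fin p))
    (hL : LinearMap.det L ≠ 0) :
    ∃ K : ℝ, 0 < K ∧ ∀ f : EuclideanSpace ℝ (Fin p) → ℝ,
      Integrable (fun w => f (L w)) → Integrable f ∧ ∫ u, f u = K * ∫ w, f (L w) := by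
  refine ⟨|LinearMap.det L|, abs_pos.2 hL, fun f hf => ?_⟩
  have hm := Measure.map_linearMap_addHaar_eq_smul_addHaar
    (volume : Measure (EuclideanSpace ℝ (Fin p))) hL
  have hemb : MeasurableEmbedding L := by
    have := (LinearEquiv.ofIsUnitDet (f := L) (v := Module.finBasis ℝ _) (v' := Module.finBasis ℝ _)
      (by rw [LinearMap.det_toMatrix]; exact hL.isUnit)).toContinuousLinearEquiv.toHomeomorph.measurableEmbedding
    exact this
  have hi : Integrable f (Measure.map L volume) := hemb.integrable_map_iff.2 hf
  rw [hm] at hi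
  have hne : ENNReal.ofReal |(LinearMap.det L)⁻¹| ≠ 0 := by
    simp [hL]
  refine ⟨(integrable_smul_measure hne ENNReal.ofReal_ne_top).1 hi, ?_⟩
  rw [← hemb.integral_map f, hm, integral_smul_measure, ENNReal.toReal_ofReal (abs_nonneg _),
    smul_eq_mul, ← mul_assoc, ← abs_mul, mul_inv_cancel₀ hL]
  simp

lemma moment_bound {p : ℕ} (DG DV : Matrix (Fin p) (Fin p) ℝ) (hDG : DG.PosDef) (hDV : DV.PosDef)
    (hLoewner : (DG * DG - DV * DV).PosSemidef) (pG : ℝ)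
    (hpG : pG = ((DV * DV) * (DG * DG)⁻¹).trace) :
    (0 < p → 0 < pG) ∧
    Integrable (fun u : EuclideanSpace ℝ (Fin p) => exp (-(gaussNorm DG u) ^ 2 / 2)) ∧
    ∀ s : ℝ, 0 < s →
      Integrable (fun u : EuclideanSpace ℝ (Fin p) =>
        exp ((1 - s) * (gaussNorm DV u) ^ 2 / 2 - (gaussNorm DG u) ^ 2 / 2)) ∧
      ∫ u : EuclideanSpace ℝ (Fin p),
        exp ((1 - s) * (gaussNorm DV u) ^ 2 / 2 - (gaussNorm DG u) ^ 2 / 2) ≤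
      s ^ (-pG / 2) * ∫ u : EuclideanSpace ℝ (Fin p), exp (-(gaussNorm DG u) ^ 2 / 2) := by
  obtain ⟨L, b, hL, hb0, hb1, hsum, hG, hV⟩ := diag_lemma DG DV hDG hDV hLoewner
  obtain ⟨K, hK, hcv⟩ := change_var L hL
  rw [← hsum] at hpG
  have h1 := gauss_pi (p := p) (fun _ => 1) (fun _ => one_pos)
  have hZ := hcv (fun u => exp (-(gaussNorm DG u) ^ 2 / 2)) (by
    simp only [hG]; simpa using h1.1)
  refine ⟨fun hp => ?_, hZ.1, fun s hs => ?_⟩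
  · rw [hpG]
    exact Finset.sum_pos (fun i _ => hb0 i) ⟨⟨0, hp⟩, Finset.mem_univ _⟩
  · have hc := fun i => one_dim_bound (hb0 i).le (hb1 i) hs
    have h2 := gauss_pi (p := p) (fun i => 1 - (1 - s) * b i) (fun i => (hc i).1)
    have e : ∀ w, exp ((1 - s) * (gaussNorm DV (L w)) ^ 2 / 2 - (gaussNorm DG (L w)) ^ 2 / 2) =
        exp (-(∑ i, (1 - (1 - s) * b i) * w i ^ 2) / 2) := by
      intro w
      rw [hG, hV]
      congr 1
      have : ∑ i, (1 - (1 - s) * b i) * w i ^ 2 =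
          ∑ i, w i ^ 2 - (1 - s) * ∑ i, b i * w i ^ 2 := by
        rw [Finset.mul_sum, ← Finset.sum_sub_distrib]
        exact Finset.sum_congr rfl fun i _ => by ring
      rw [this]; ring
    have hX := hcv (fun u => exp ((1 - s) * (gaussNorm DV u) ^ 2 / 2 - (gaussNorm DG u) ^ 2 / 2))
      (by simp only [e]; exact h2.1)
    refine ⟨hX.1, ?_⟩
    rw [hX.2, hZ.2]
    simp only [e]
    rw [h2.2]
    have e1 : ∫ w, exp (-(gaussNorm DG (L w)) ^ 2 / 2) = ∏ i : Fin p, √(π / (1 / 2)) := by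
      rw [← h1.2]; simp only [hG, one_mul]
    rw [e1]
    have e2 : s ^ (-pG / 2) = ∏ i, s ^ (-b i / 2) := by
      rw [← Real.rpow_sum_of_pos hs, hpG, neg_div, Finset.sum_div, ← Finset.sum_neg_distrib]
      simp only [neg_div]
    rw [e2, mul_left_comm, ← Finset.prod_mul_distrib]
    refine mul_le_mul_of_nonneg_left ?_ hK.le
    exact Finset.prod_le_prod (fun i _ => Real.sqrt_nonneg _) (fun i _ => (hc i).2)

lemma lint_gauss {b : ℝ} (hb : 0 < b) :
    ∫⁻ y in Set.Ioi (0:ℝ), ENNReal.ofReal (exp (-b * y ^ 2)) = ENNReal.ofReal (√(π / b) / 2) := by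
  rw [← integral_gaussian_Ioi, ofReal_integral_eq_lintegral_ofReal]
  · exact (integrable_exp_neg_mul_sq hb).integrableOn
  · exact Filter.Eventually.of_forall fun _ => (exp_pos _).le

lemma mixture_bound {c : ℝ} (hc : 0 < c) :
    ENNReal.ofReal (exp (-c)) ≤ ENNReal.ofReal (2 * √(2 / π)) *
      ∫⁻ y in Set.Ioi (0:ℝ), ENNReal.ofReal (exp (-y ^ 2 / 2 - c ^ 2 / (2 * y ^ 2))) := by
  set d := √c with hd
  have hd0 : 0 < d := Real.sqrt_pos.2 hc
  have hdc : d ^ 2 = c := Real.sq_sqrt hc.le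
  have h1 : ENNReal.ofReal (exp (-c)) * ENNReal.ofReal (√(π / 2) / 2) ≤
      ∫⁻ y in Set.Ioi (0:ℝ), ENNReal.ofReal (exp (-y ^ 2 / 2 - c ^ 2 / (2 * y ^ 2))) := by
    rw [← lint_gauss two_pos]
    have hsh := (measurePreserving_sub_right (volume : Measure ℝ) d).setLIntegral_comp_preimage
      (measurableSet_Ioi (a := (0:ℝ))) (f := fun y => ENNReal.ofReal (exp (-2 * y ^ 2))) (by fun_prop)
    rw [← hsh]
    have hpre : (fun x => x - d) ⁻¹' Set.Ioi (0:ℝ) = Set.Ioi d := by ext; simp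
    rw [hpre, ← lintegral_const_mul _ (by fun_prop)]
    refine le_trans ?_ (lintegral_mono_set (Set.Ioi_subset_Ioi hd0.le))
    refine setLIntegral_mono (by fun_prop) fun y hy => ?_
    rw [← ENNReal.ofReal_mul (exp_pos _).le, ← exp_add]
    apply ENNReal.ofReal_le_ofReal
    apply exp_le_exp.2
    have hy : d < y := hy
    have hy0 : 0 < y := hd0.trans hy
    have e : -y ^ 2 / 2 - c ^ 2 / (2 * y ^ 2) = -c - (y - d) ^ 2 * ((y + d) / y) ^ 2 / 2 := by
      rw [← hdc]; field_simp; ring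
    rw [e]
    have h2 : (y + d) / y ≤ 2 := by rw [div_le_iff₀ hy0]; linarith
    have h3 : 0 ≤ (y + d) / y := by positivity
    have h4 : ((y + d) / y) ^ 2 ≤ 4 := by nlinarith
    nlinarith [mul_le_mul_of_nonneg_left h4 (sq_nonneg (y - d))]
  refine le_trans ?_ (mul_le_mul_right h1 _)
  rw [← ENNReal.ofReal_mul (exp_pos _).le, ← ENNReal.ofReal_mul (by positivity)]
  apply ENNReal.ofReal_le_ofReal
  have : √(2 / π) * √(π / 2) = 1 := by
    rw [← Real.sqrt_mul (by positivity)]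
    rw [div_mul_div_comm, mul_comm, div_self (by positivity), Real.sqrt_one]
  have : 2 * √(2 / π) * (exp (-c) * (√(π / 2) / 2)) = exp (-c) * (√(2 / π) * √(π / 2)) := by ring
  rw [this, ‹√(2 / π) * √(π / 2) = 1›, mul_one]

lemma rpow_bound {q y : ℝ} (hq : 0 < q) (hy : 0 < y) :
    ((q / 2) ^ 2 / y ^ 2) ^ (-(q ^ 2) / 2) ≤ exp (q ^ 2 / 2 + 3 * y ^ 2 / 8) := by
  have hs : 0 < (q / 2) ^ 2 / y ^ 2 := by positivity
  rw [Real.rpow_def_of_pos hs]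
  apply exp_le_exp.2
  set s := (q / 2) ^ 2 / y ^ 2 with hsdef
  have h1 : -log s ≤ 1 + 3 / 16 * s⁻¹ := by
    have h2 := Real.log_le_sub_one_of_pos (show 0 < s⁻¹ * exp (-2) by positivity)
    rw [Real.log_mul (by positivity) (exp_pos _).ne', Real.log_inv, Real.log_exp] at h2
    have h3 : exp (-2) ≤ 3 / 16 := by
      rw [exp_neg, inv_le_comm₀ (exp_pos _) (by norm_num)]
      have := Real.exp_one_gt_d9
      have e : exp 2 = exp 1 * exp 1 := by rw [← exp_add]; norm_num
      rw [e]; nlinarith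
    have := mul_le_mul_of_nonneg_left h3 (inv_pos.2 hs).le
    linarith
  have h4 : q ^ 2 / 2 * s⁻¹ = 2 * y ^ 2 := by rw [hsdef]; field_simp; try norm_num
  have h5 := mul_le_mul_of_nonneg_left h1 (show 0 ≤ q ^ 2 / 2 by positivity)
  nlinarith

lemma gaussNorm_continuous {p : ℕ} (D : Matrix (Fin p) (Fin p) ℝ) :
    Continuous (gaussNorm D) := by
  unfold gaussNorm
  exact (LinearMap.continuous_of_finiteDimensional _).norm

lemma rpow_le_exp_half {t m : ℝ} (ht : 0 < t) (hm : 0 ≤ m) : t ^ m ≤ exp (m * t / 2) := by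
  rw [Real.rpow_def_of_pos ht]
  apply exp_le_exp.2
  have h1 := Real.log_le_sub_one_of_pos (show 0 < t / 2 by positivity)
  rw [Real.log_div ht.ne' two_ne_zero] at h1
  have h2 := Real.log_two_lt_d9
  nlinarith

lemma integral_le_of_lintegral {α : Type*} [MeasurableSpace α] {μ : Measure α} {f : α → ℝ} {C : ℝ}
    (hC : 0 ≤ C) (hf : ∀ x, 0 ≤ f x)
    (h : ∫⁻ x, ENNReal.ofReal (f x) ∂μ ≤ ENNReal.ofReal C) : ∫ x, f x ∂μ ≤ C := by
  by_cases hi : Integrable f μ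
  · rw [← ofReal_integral_eq_lintegral_ofReal hi (Filter.Eventually.of_forall hf)] at h
    exact (ENNReal.ofReal_le_ofReal_iff hC).1 h
  · rw [integral_undef hi]; exact hC

lemma conc_bound {p : ℕ} (DV : Matrix (Fin p) (Fin p) ℝ)
    (ℓ : EuclideanSpace ℝ (Fin p) → ℝ) (hℓconc : ConcaveOn ℝ Set.univ ℓ)
    (ν rG : ℝ) (hν0 : 0 < ν) (hrGpos : 0 < rG)
    (ω : ℝ) (hων : ω ≤ 1 - ν)
    (hδ : ∀ u, gaussNorm DV u ≤ rG / ν →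
      |ℓ u - ℓ 0 - fderiv ℝ ℓ 0 u + (gaussNorm DV u) ^ 2 / 2| ≤
        ω * (gaussNorm DV u) ^ 2 / 2) (u : EuclideanSpace ℝ (Fin p))
    (hu : rG / ν < gaussNorm DV u) :
    ℓ u - ℓ 0 - fderiv ℝ ℓ 0 u ≤ -(rG * gaussNorm DV u / 2) := by
  set t := gaussNorm DV u with ht
  set R := rG / ν with hR
  have hR0 : 0 < R := by positivity
  have ht0 : 0 < t := hR0.trans hu
  set σ := R / t with hσ
  have hσ0 : 0 < σ := by positivity
  have hσ1 : σ < 1 := (div_lt_one ht0).2 hu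
  have hσt : σ * t = R := div_mul_cancel₀ _ ht0.ne'
  have hVσ : gaussNorm DV (σ • u) = R := by
    rw [← hσt, ht]
    simp [gaussNorm, norm_smul, abs_of_pos hσ0]
  have h1 := hδ (σ • u) hVσ.le
  rw [hVσ] at h1
  have h2 := (abs_le.1 h1).2
  have h3 := hℓconc.2 (Set.mem_univ u) (Set.mem_univ 0) hσ0.le (sub_nonneg.2 hσ1.le) (by ring)
  simp only [smul_zero, add_zero, smul_eq_mul] at h3
  rw [map_smul, smul_eq_mul] at h2
  have h4 : ν * R = rG := by rw [hR]; field_simp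
  have h5 : ω * R ^ 2 ≤ (1 - ν) * R ^ 2 := mul_le_mul_of_nonneg_right hων (sq_nonneg R)
  have h6 : ν * R ^ 2 = rG * (σ * t) := by rw [hσt, ← h4]; ring
  have h7 : σ * (ℓ u - ℓ 0 - fderiv ℝ ℓ 0 u) ≤ σ * (-(rG * t / 2)) := by nlinarith
  exact le_of_mul_le_mul_left h7 hσ0

lemma claim_two {p : ℕ} (DG DV : Matrix (Fin p) (Fin p) ℝ)
    (q c m rG Z : ℝ) (hq : 0 < q) (hc : 2 ≤ c) (hm : 0 ≤ m) (hZ0 : 0 ≤ Z)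
    (hr : 2 * q + c + m ≤ rG)
    (hmom : ∀ s : ℝ, 0 < s → ∫⁻ u : EuclideanSpace ℝ (Fin p), ENNReal.ofReal
        (exp ((1 - s) * (gaussNorm DV u) ^ 2 / 2 - (gaussNorm DG u) ^ 2 / 2)) ≤
      ENNReal.ofReal (s ^ (-(q ^ 2) / 2) * Z))
    (S : Set (EuclideanSpace ℝ (Fin p))) (hSm : MeasurableSet S) (hS : ∀ u ∈ S, rG ≤ gaussNorm DV u) :
    ∫⁻ u in S, ENNReal.ofReal ((gaussNorm DV u) ^ m * exp (-(gaussNorm DG u) ^ 2 / 2)) ≤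
      ENNReal.ofReal (exp (-(c ^ 2 / 2) - q ^ 2 / 2) * Z) := by
  have hVc := gaussNorm_continuous DV
  have hGc := gaussNorm_continuous DG
  have hr0 : 0 < rG := by linarith
  set s := q / rG with hs
  have hs0 : 0 < s := by positivity
  have hsr : s * rG = q := div_mul_cancel₀ _ hr0.ne'
  have hs1 : s ≤ 1 := (div_le_one hr0).2 (by linarith)
  have key : ∫⁻ u in S, ENNReal.ofReal ((gaussNorm DV u) ^ m * exp (-(gaussNorm DG u) ^ 2 / 2)) ≤
      ENNReal.ofReal (exp (m * rG / 2 - (1 - s) * rG ^ 2 / 2)) *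
      ∫⁻ u : EuclideanSpace ℝ (Fin p), ENNReal.ofReal
        (exp ((1 - s) * (gaussNorm DV u) ^ 2 / 2 - (gaussNorm DG u) ^ 2 / 2)) := by
    rw [← lintegral_const_mul _ (by fun_prop)]
    refine le_trans ?_ (setLIntegral_le_lintegral S _)
    refine setLIntegral_mono' hSm fun u hu => ?_
    rw [← ENNReal.ofReal_mul (exp_pos _).le]
    apply ENNReal.ofReal_le_ofReal
    have ht := hS u hu
    set t := gaussNorm DV u
    have ht0 : 0 < t := hr0.trans_le ht
    refine (mul_le_mul_of_nonneg_right (rpow_le_exp_half ht0 hm) (exp_pos _).le).trans ?_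
    rw [← exp_add, ← exp_add]
    apply exp_le_exp.2
    have h1 : m ≤ (1 - s) * (t + rG) := by nlinarith
    nlinarith [mul_nonneg (sub_nonneg.2 ht) (sub_nonneg.2 h1)]
  refine key.trans ((mul_le_mul_right (hmom s hs0) _).trans ?_)
  rw [← ENNReal.ofReal_mul (exp_pos _).le, ← mul_assoc]
  apply ENNReal.ofReal_le_ofReal
  refine mul_le_mul_of_nonneg_right ?_ hZ0
  rw [Real.rpow_def_of_pos hs0, ← exp_add]
  apply exp_le_exp.2
  have h2 : -log s ≤ s⁻¹ - 1 := by
    rw [← Real.log_inv]; exact Real.log_le_sub_one_of_pos (inv_pos.2 hs0)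
  have h3 : q ^ 2 * s⁻¹ = q * rG := by rw [hs]; field_simp
  have h4 := mul_le_mul_of_nonneg_left h2 (sq_nonneg q)
  have h5 : s * rG ^ 2 = q * rG := by rw [← hsr]; ring
  have h6 : c ^ 2 ≤ rG * (rG - 2 * q - m) := by nlinarith
  nlinarith

lemma claim_one {p : ℕ} (DG DV : Matrix (Fin p) (Fin p) ℝ)
    (q c m rG Z : ℝ) (hq : 0 < q) (hc : 2 ≤ c) (hm : 0 ≤ m) (hZ0 : 0 ≤ Z)
    (hr : 2 * q + c + m ≤ rG)
    (hmom : ∀ s : ℝ, 0 < s → ∫⁻ u : EuclideanSpace ℝ (Fin p), ENNReal.ofReal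
        (exp ((1 - s) * (gaussNorm DV u) ^ 2 / 2 - (gaussNorm DG u) ^ 2 / 2)) ≤
      ENNReal.ofReal (s ^ (-(q ^ 2) / 2) * Z))
    (F : EuclideanSpace ℝ (Fin p) → ℝ)
    (S : Set (EuclideanSpace ℝ (Fin p))) (hSm : MeasurableSet S) (hS : ∀ u ∈ S, rG ≤ gaussNorm DV u)
    (hF : ∀ u ∈ S, F u ≤ -(rG * gaussNorm DV u / 2) + (gaussNorm DV u) ^ 2 / 2
      - (gaussNorm DG u) ^ 2 / 2) :
    ∫⁻ u in S, ENNReal.ofReal ((gaussNorm DV u) ^ m * exp (F u)) ≤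
      ENNReal.ofReal (4 * exp (-(c ^ 2 / 2) - q ^ 2 / 2) * Z) := by
  have hVc := (gaussNorm_continuous DV).measurable
  have hGc := (gaussNorm_continuous DG).measurable
  have hr0 : 0 < rG := by linarith
  set A := exp (-(rG * (rG - m - q) / 2)) with hA
  have hA0 : 0 < A := exp_pos _
  set K := 2 * √(2 / π) with hK
  have hK0 : 0 < K := by positivity
  have key : ∫⁻ u in S, ENNReal.ofReal ((gaussNorm DV u) ^ m * exp (F u)) ≤
      ENNReal.ofReal (A * K) * ∫⁻ u : EuclideanSpace ℝ (Fin p), ∫⁻ y in Set.Ioi (0:ℝ),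
        ENNReal.ofReal (exp (-y ^ 2 / 2)) * ENNReal.ofReal
        (exp ((1 - (q / 2) ^ 2 / y ^ 2) * (gaussNorm DV u) ^ 2 / 2 - (gaussNorm DG u) ^ 2 / 2)) := by
    refine le_trans ?_ (mul_le_mul_right (setLIntegral_le_lintegral S _) _)
    rw [← lintegral_const_mul' _ _ ENNReal.ofReal_ne_top]
    refine setLIntegral_mono' hSm fun u hu => ?_
    have ht := hS u hu
    have hFu := hF u hu
    set t := gaussNorm DV u
    set g := gaussNorm DG u
    have ht0 : 0 < t := hr0.trans_le ht
    have hmix := mixture_bound (c := q / 2 * t) (by positivity)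
    have e1 : ENNReal.ofReal (t ^ m * exp (F u)) ≤ ENNReal.ofReal A *
        (ENNReal.ofReal (exp (t ^ 2 / 2 - g ^ 2 / 2)) * ENNReal.ofReal (exp (-(q / 2 * t)))) := by
      rw [← ENNReal.ofReal_mul (exp_pos _).le, ← ENNReal.ofReal_mul hA0.le]
      apply ENNReal.ofReal_le_ofReal
      refine (mul_le_mul_of_nonneg_right (rpow_le_exp_half ht0 hm) (exp_pos _).le).trans ?_
      rw [hA, ← exp_add, ← exp_add, ← exp_add]
      apply exp_le_exp.2
      nlinarith [mul_nonneg (sub_nonneg.2 ht) (show 0 ≤ rG - m - q by linarith)]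
    refine e1.trans ?_
    have e2 : ∀ y ∈ Set.Ioi (0:ℝ), ENNReal.ofReal (exp (t ^ 2 / 2 - g ^ 2 / 2)) *
        ENNReal.ofReal (exp (-y ^ 2 / 2 - (q / 2 * t) ^ 2 / (2 * y ^ 2))) =
        ENNReal.ofReal (exp (-y ^ 2 / 2)) * ENNReal.ofReal
        (exp ((1 - (q / 2) ^ 2 / y ^ 2) * t ^ 2 / 2 - g ^ 2 / 2)) := by
      intro y hy
      have hy : 0 < y := hy
      rw [← ENNReal.ofReal_mul (exp_pos _).le, ← ENNReal.ofReal_mul (exp_pos _).le, ← exp_add,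
        ← exp_add]
      congr 2
      field_simp
      ring
    rw [← setLIntegral_congr_fun measurableSet_Ioi e2,
      lintegral_const_mul' _ _ ENNReal.ofReal_ne_top, ENNReal.ofReal_mul hA0.le]
    calc _ ≤ ENNReal.ofReal A * (ENNReal.ofReal (exp (t ^ 2 / 2 - g ^ 2 / 2)) *
          (ENNReal.ofReal K * ∫⁻ y in Set.Ioi (0:ℝ),
            ENNReal.ofReal (exp (-y ^ 2 / 2 - (q / 2 * t) ^ 2 / (2 * y ^ 2))))) := by gcongr
      _ = _ := by ring
  refine key.trans ?_
  rw [lintegral_lintegral_swap (by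
    apply Measurable.aemeasurable
    fun_prop)]
  have step : ∫⁻ y in Set.Ioi (0:ℝ), ∫⁻ u : EuclideanSpace ℝ (Fin p),
        ENNReal.ofReal (exp (-y ^ 2 / 2)) * ENNReal.ofReal
        (exp ((1 - (q / 2) ^ 2 / y ^ 2) * (gaussNorm DV u) ^ 2 / 2 - (gaussNorm DG u) ^ 2 / 2)) ≤
      ENNReal.ofReal (exp (q ^ 2 / 2) * Z) * ENNReal.ofReal (√(π / (1 / 8)) / 2) := by
    rw [← lint_gauss (by norm_num : (0:ℝ) < 1 / 8), ← lintegral_const_mul' _ _ ENNReal.ofReal_ne_top]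
    refine setLIntegral_mono' measurableSet_Ioi fun y hy => ?_
    have hy : 0 < y := hy
    rw [lintegral_const_mul' _ _ ENNReal.ofReal_ne_top]
    refine (mul_le_mul_right (hmom _ (by positivity)) _).trans ?_
    rw [← ENNReal.ofReal_mul (exp_pos _).le, ← ENNReal.ofReal_mul (by positivity)]
    apply ENNReal.ofReal_le_ofReal
    have h1 := rpow_bound hq hy
    calc _ ≤ exp (-y ^ 2 / 2) * (exp (q ^ 2 / 2 + 3 * y ^ 2 / 8) * Z) := by gcongr
      _ = (exp (-y ^ 2 / 2) * exp (q ^ 2 / 2 + 3 * y ^ 2 / 8)) * Z := by ring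
      _ = (exp (q ^ 2 / 2) * exp (-(1 / 8) * y ^ 2)) * Z := by
        rw [← exp_add, ← exp_add]; ring_nf
      _ = _ := by ring
  refine (mul_le_mul_right step _).trans ?_
  rw [← ENNReal.ofReal_mul (by positivity), ← ENNReal.ofReal_mul (by positivity)]
  apply ENNReal.ofReal_le_ofReal
  have hsq : √(2 / π) * √(π / (1 / 8)) = 4 := by
    rw [← Real.sqrt_mul (by positivity)]
    have : 2 / π * (π / (1 / 8)) = 4 ^ 2 := by
      have := pi_pos.ne'
      field_simp; norm_num
    rw [this, Real.sqrt_sq (by norm_num)]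
  have e3 : A * K * (exp (q ^ 2 / 2) * Z * (√(π / (1 / 8)) / 2)) =
      4 * (A * exp (q ^ 2 / 2)) * Z := by
    rw [hK, ← hsq]; ring
  rw [e3]
  have : A * exp (q ^ 2 / 2) ≤ exp (-(c ^ 2 / 2) - q ^ 2 / 2) := by
    rw [hA, ← exp_add]
    apply exp_le_exp.2
    have : (2 * q + c) * (q + c) ≤ rG * (rG - m - q) := by
      apply mul_le_mul <;> linarith
    nlinarith
  gcongr

theorem stmt_14 (p : ℕ)
    (DG DV : Matrix (Fin p) (Fin p) ℝ) (hDG : DG.PosDef) (hDV : DV.PosDef)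
    (hLoewner : (DG * DG - DV * DV).PosSemidef)
    (pG Z : ℝ) (hpG : pG = ((DV * DV) * (DG * DG)⁻¹).trace)
    (hZ : Z = ∫ u : EuclideanSpace ℝ (Fin p), exp (-(gaussNorm DG u) ^ 2 / 2))
    (ℓ : EuclideanSpace ℝ (Fin p) → ℝ)
    (hℓconc : ConcaveOn ℝ Set.univ ℓ) (hℓsmooth : ContDiff ℝ 2 ℓ)
    (hℓhess : ∀ u, iteratedFDeriv ℝ 2 ℓ 0 ![u, u] = -(gaussNorm DV u) ^ 2)
    (F : EuclideanSpace ℝ (Fin p) → ℝ)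
    (hF : ∀ u, F u = ℓ u - ℓ 0 - fderiv ℝ ℓ 0 u -
      (gaussNorm DG u) ^ 2 / 2 + (gaussNorm DV u) ^ 2 / 2)
    (ν xx rG : ℝ) (hν0 : 0 < ν) (hν1 : ν < 1) (hxx : 2 ≤ xx) (hrGpos : 0 < rG)
    (U : Set (EuclideanSpace ℝ (Fin p)))
    (hUdef : U = {u | gaussNorm DV u ≤ rG / ν})
    (ω : ℝ) (hω0 : 0 ≤ ω) (hων : ω ≤ 1 - ν)
    (hδ : ∀ u ∈ U,
      |ℓ u - ℓ 0 - fderiv ℝ ℓ 0 u + (gaussNorm DV u) ^ 2 / 2| ≤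
        ω * (gaussNorm DV u) ^ 2 / 2)
    (m : ℝ) (hm : 0 ≤ m)
    (hrG : 2 * Real.sqrt pG + Real.sqrt (2 * xx) + m ≤ rG) :
    (∫ u in Uᶜ, (gaussNorm DV u) ^ m * exp (F u)) ≤ 4 * exp (-xx - pG / 2) * Z
    ∧ (∫ u in Uᶜ, (gaussNorm DV u) ^ m * exp (-(gaussNorm DG u) ^ 2 / 2)) ≤
        exp (-xx - pG / 2) * Z := by
  obtain ⟨hpos, hint, hmom⟩ := moment_bound DG DV hDG hDV hLoewner pG hpG
  have hZ0 : 0 ≤ Z := by rw [hZ]; exact integral_nonneg fun _ => (exp_pos _).le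
  have hVnn : ∀ u, 0 ≤ gaussNorm DV u := fun u => norm_nonneg _
  have hRr : rG ≤ rG / ν := by rw [le_div_iff₀ hν0]; nlinarith
  rcases Nat.eq_zero_or_pos p with hp | hp
  · subst hp
    have hU : Uᶜ = ∅ := by
      rw [hUdef, Set.compl_empty_iff, Set.eq_univ_iff_forall]
      intro u
      have : gaussNorm DV u = 0 := by
        rw [gaussNorm, Subsingleton.elim ((Matrix.toEuclideanLin DV) u) 0, norm_zero]
      rw [Set.mem_setOf_eq, this]
      positivity
    rw [hU]
    simp only [Measure.restrict_empty, integral_zero_measure]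
    constructor <;> positivity
  · have hpG0 := hpos hp
    set q := √pG with hqdef
    set c := √(2 * xx) with hcdef
    have hq : 0 < q := Real.sqrt_pos.2 hpG0
    have hq2 : q ^ 2 = pG := Real.sq_sqrt hpG0.le
    have hc2 : c ^ 2 = 2 * xx := Real.sq_sqrt (by linarith)
    have hc : 2 ≤ c := Real.le_sqrt_of_sq_le (by linarith)
    have hmom' : ∀ s : ℝ, 0 < s → ∫⁻ u : EuclideanSpace ℝ (Fin p), ENNReal.ofReal
        (exp ((1 - s) * (gaussNorm DV u) ^ 2 / 2 - (gaussNorm DG u) ^ 2 / 2)) ≤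
        ENNReal.ofReal (s ^ (-(q ^ 2) / 2) * Z) := by
      intro s hs
      obtain ⟨h1, h2⟩ := hmom s hs
      rw [← ofReal_integral_eq_lintegral_ofReal h1
        (Filter.Eventually.of_forall fun _ => (exp_pos _).le), hq2, hZ]
      exact ENNReal.ofReal_le_ofReal h2
    have hSm : MeasurableSet Uᶜ := by
      rw [hUdef]
      exact (measurableSet_le (gaussNorm_continuous DV).measurable measurable_const).compl
    have hUc : ∀ u ∈ Uᶜ, rG / ν < gaussNorm DV u := by
      intro u hu
      rw [hUdef] at hu
      simpa using hu
    have hS : ∀ u ∈ Uᶜ, rG ≤ gaussNorm DV u := fun u hu => hRr.trans (hUc u hu).le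
    have hexp : -xx - pG / 2 = -(c ^ 2 / 2) - q ^ 2 / 2 := by rw [hc2, hq2]; ring
    rw [hexp]
    constructor
    · refine integral_le_of_lintegral (by positivity)
        (fun u => mul_nonneg (Real.rpow_nonneg (hVnn u) _) (exp_pos _).le) ?_
      refine claim_one DG DV q c m rG Z hq hc hm hZ0 hrG hmom' F Uᶜ hSm hS fun u hu => ?_
      have := conc_bound DV ℓ hℓconc ν rG hν0 hrGpos ω hων
        (fun u hu => hδ u (by rw [hUdef]; exact hu)) u (hUc u hu)
      rw [hF]
      linarith
    · refine integral_le_of_lintegral (by positivity)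
        (fun u => mul_nonneg (Real.rpow_nonneg (hVnn u) _) (exp_pos _).le) ?_
      exact claim_two DG DV q c m rG Z hq hc hm hZ0 hrG hmom' Uᶜ hSm hS
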